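/- Let t : V × V → ℝ be nonnegative travel times satisfying the triangle inequality, let θ be a route ending at customer i, and let θ' = θ ⊕ (u_1, ..., u_L) be an extension by customers u_1, ..., u_L. Then for every 1 ≤ k ≤ L, the arrival time at u_k along θ' satisfies a_{θ'}(u_k; t) ≥ s_θ(i; t) + t(i, u_k). (Adding intermediate customers to a route between i and u_k can only increase the arrival time at u_k.) -/

import Mathlib

open Finset

namespace CSVRPTW

/-- The node set `V = {0, 1, …, N}`: node `0` is the depot, `1, …, N` are customers. -/
abbrev V (N : ℕ) := Fin (N + 1)

variable {N : ℕ} {Ω : Type*} [Fintype Ω] [Nonempty Ω]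

/-- Helper for the arrival-time recursion: `p` is the previous node and `ap` the arrival
time at `p`; returns the arrival time at the last node of the remaining list
(or `ap` if the list is empty). -/
def arrGo (t : V N → V N → ℝ) (e : V N → ℝ) : V N → ℝ → List (V N) → ℝ
  | _, ap, [] => ap
  | p, ap, v :: rest => arrGo t e v (max (e p) ap + t p v) rest

/-- Arrival time at the last node of a route (junk value `0` for the empty list):
`a_θ(v₁; t) = t(0, v₁)` and `a_θ(v_k; t) = max (e v_{k-1}) (a_θ(v_{k-1}; t)) + t v_{k-1} v_k`. -/
def arrLast (t : V N → V N → ℝ) (e : V N → ℝ) : List (V N) → ℝ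
  | [] => 0
  | v :: rest => arrGo t e v (t 0 v) rest

/-- Arrival time `a_θ(v_{k+1}; t)` at the node in (0-indexed) position `k` of `θ`. -/
def arr (t : V N → V N → ℝ) (e : V N → ℝ) (θ : List (V N)) (k : ℕ) : ℝ :=
  arrLast t e (θ.take (k + 1))

/-- Service start time `s_θ(v_{k+1}; t)` at the node in (0-indexed) position `k` of `θ`. -/
def srv (t : V N → V N → ℝ) (e : V N → ℝ) (θ : List (V N)) (k : ℕ) : ℝ :=
  max (e (θ.getD k 0)) (arr t e θ k)

/-- Service start time at the last node of a route. -/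
def srvLast (t : V N → V N → ℝ) (e : V N → ℝ) (θ : List (V N)) : ℝ :=
  max (e (θ.getLastD 0)) (arrLast t e θ)

/-- Earliest service start time `τ_θ = min_{ω ∈ Ω} s_θ(i; t^ω)` of a route `θ`
ending at its last customer. -/
def tau (tw : Ω → V N → V N → ℝ) (e : V N → ℝ) (θ : List (V N)) : ℝ :=
  univ.inf' univ_nonempty fun ω => srvLast (tw ω) e θ

/-- Helper: cost of the path starting at `p`, visiting the list in order,
and returning to the depot. -/
def costGo (c : V N → V N → ℝ) : V N → List (V N) → ℝ
  | p, [] => c p 0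
  | p, v :: rest => c p v + costGo c v rest

/-- Transportation cost `C_θ = c(0,v₁) + Σ_{k=2}^L c(v_{k-1},v_k) + c(v_L,0)` of a route. -/
def cost (c : V N → V N → ℝ) : List (V N) → ℝ
  | [] => 0
  | v :: rest => c 0 v + costGo c v rest

/-- Load `q_θ = Σ_{k=1}^L q(v_k)` of a route. -/
def load (q : V N → ℝ) (θ : List (V N)) : ℝ := (θ.map q).sum

/-- Total late-arrival penalty `Σ_{k=1}^L π(a_θ(v_k; t) − ℓ(v_k))` of route `θ`
under travel times `t`. -/
def penaltySum (π : ℝ → ℝ) (ℓ : V N → ℝ) (t : V N → V N → ℝ) (e : V N → ℝ)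
    (θ : List (V N)) : ℝ :=
  ∑ k : Fin θ.length, π (arr t e θ k.val - ℓ (θ.get k))

/-- Reduced cost
`C̄_θ = C_θ + Σ_ω α^ω Σ_k π(a_θ(v_k; t^ω) − ℓ(v_k)) − Σ_k γ(v_k) − μ` of a route. -/
def redCost (c : V N → V N → ℝ) (π : ℝ → ℝ) (ℓ γ : V N → ℝ) (μ : ℝ)
    (α : Ω → ℝ) (tw : Ω → V N → V N → ℝ) (e : V N → ℝ) (θ : List (V N)) : ℝ :=
  cost c θ + (∑ ω : Ω, α ω * penaltySum π ℓ (tw ω) e θ)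
    - (∑ k : Fin θ.length, γ (θ.get k)) - μ

/-- A route: a nonempty list of pairwise distinct customers. -/
def IsRoute (θ : List (V N)) : Prop := θ ≠ [] ∧ θ.Nodup ∧ ∀ v ∈ θ, v ≠ 0

/-- `d` satisfies the triangle inequality. -/
def Triangle (d : V N → V N → ℝ) : Prop := ∀ u v w, d u w ≤ d u v + d v w

/-- Running the arrival recursion along `l₁ ++ l₂` is running it along `l₁`, then along `l₂`
from the last node of `l₁`. -/
theorem arrGo_append {N : ℕ} (t : V N → V N → ℝ) (e : V N → ℝ) (l₁ l₂ : List (V N))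
    (p : V N) (ap : ℝ) :
    arrGo t e p ap (l₁ ++ l₂) = arrGo t e (l₁.getLastD p) (arrGo t e p ap l₁) l₂ := by
  induction l₁ generalizing p ap with
  | nil => rfl
  | cons v rest ih => simp only [List.cons_append, arrGo, ih, List.getLastD_cons]

/-- Running the arrival recursion along a nonempty route `θ` extended by `l`. -/
theorem arrLast_append {N : ℕ} (t : V N → V N → ℝ) (e : V N → ℝ) {θ : List (V N)}
    (hθ : θ ≠ []) (l : List (V N)) :
    arrLast t e (θ ++ l) = arrGo t e (θ.getLastD 0) (arrLast t e θ) l := by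
  cases θ with
  | nil => exact absurd rfl hθ
  | cons v rest => simp only [List.cons_append, arrLast, arrGo_append, List.getLastD_cons]

/-- Going directly from `p` to the node in position `k` of `l` is no slower than following `l`. -/
theorem Triangle.max_add_le_arrGo_take {N : ℕ} {t : V N → V N → ℝ} (htri : Triangle t)
    (e : V N → ℝ) (l : List (V N)) (p : V N) (ap : ℝ) (k : ℕ) (hk : k < l.length) :
    max (e p) ap + t p l[k] ≤ arrGo t e p ap (l.take (k + 1)) := by
  induction l generalizing p ap k with
  | nil => simp at hk
  | cons v rest ih =>
    cases k with
    | zero => simp [arrGo]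
    | succ k =>
      have hk' : k < rest.length := by simpa using hk
      have h := ih v (max (e p) ap + t p v) k hk'
      simp only [List.take_succ_cons, arrGo, List.getElem_cons_succ] at h ⊢
      linarith [htri p v rest[k], le_max_right (e v) (max (e p) ap + t p v)]

/-- For nonnegative travel times satisfying the triangle inequality, adding intermediate
customers to a route between `i` and `u_k` can only increase the arrival time at `u_k`:
along `θ' = θ ⊕ (u₁, …, u_L)` one has `a_{θ'}(u_k; t) ≥ s_θ(i; t) + t(i, u_k)`. -/
theorem arrival_after_extension_lower_bound
    {N : ℕ}
    (t : V N → V N → ℝ) (e : V N → ℝ)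
    (ht : ∀ u v : V N, 0 ≤ t u v) (htri : Triangle t)
    (θ : List (V N)) (i : V N)
    (hθ : IsRoute θ) (hi : i ≠ 0) (hlast : θ.getLastD 0 = i)
    (us : List (V N)) (huscust : ∀ u ∈ us, u ≠ 0) :
    ∀ k : Fin us.length,
      srvLast t e θ + t i (us.get k) ≤ arr t e (θ ++ us) (θ.length + k.val) := by
  intro k
  have htake : (θ ++ us).take (θ.length + k.val + 1) = θ ++ us.take (k.val + 1) := by
    rw [add_assoc, List.take_length_add_append]
  rw [arr, htake, arrLast_append t e hθ.1, srvLast, hlast]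
  exact htri.max_add_le_arrGo_take e us i _ k k.isLt

end CSVRPTW
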